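/- arXiv:2101.09448 — 3 statements merged into one kernel-verified Lean document; each statement's English description precedes it below -/
import Mathlib

section
/- Let s, t, u, v be positive integers such that either s and t are both odd, or u and v are both odd. Then the graph Γ_ℝ(X^s Y^t, X^u Y^v) has girth at least six (i.e., it contains no 4-cycle). -/
/-- The algebraically defined bipartite graph `Γ_R(f₂, f₃)`: the first summand consists of
points `(a₁,a₂,a₃)`, the second of lines `[x₁,x₂,x₃]`; a point is adjacent to a line iff
`a₂ + x₂ = f₂ (a₁, x₁)` and `a₃ + x₃ = f₃ (a₁, x₁)`. -/
def adGraph (R : Type*) [CommRing R] (f₂ f₃ : R × R → R) :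
    SimpleGraph ((R × R × R) ⊕ (R × R × R)) :=
  SimpleGraph.fromRel (fun u v =>
    ∃ a x : R × R × R, u = Sum.inl a ∧ v = Sum.inr x ∧
      a.2.1 + x.2.1 = f₂ (a.1, x.1) ∧ a.2.2 + x.2.2 = f₃ (a.1, x.1))

/-- The real monomial graph `Γ_ℝ(X^s Y^t, X^u Y^v)`. -/
noncomputable def monGraph (s t u v : ℕ) : SimpleGraph ((ℝ × ℝ × ℝ) ⊕ (ℝ × ℝ × ℝ)) :=
  adGraph ℝ (fun p => p.1 ^ s * p.2 ^ t) (fun p => p.1 ^ u * p.2 ^ v)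

section adGraph

variable {R : Type*} [CommRing R] {f₂ f₃ : R × R → R}

@[simp]
lemma adGraph_adj_inl_inr (a x : R × R × R) :
    (adGraph R f₂ f₃).Adj (Sum.inl a) (Sum.inr x) ↔
      a.2.1 + x.2.1 = f₂ (a.1, x.1) ∧ a.2.2 + x.2.2 = f₃ (a.1, x.1) := by
  constructor
  · simp only [adGraph, SimpleGraph.fromRel_adj]
    rintro ⟨-, ⟨a, x, ha, hx, h⟩ | ⟨_, _, h, -⟩⟩
    · cases ha
      cases hx
      exact h
    · cases h
  · exact fun h => ⟨Sum.inl_ne_inr, .inl ⟨a, x, rfl, rfl, h⟩⟩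

@[simp]
lemma not_adGraph_adj_inl_inl (a b : R × R × R) :
    ¬ (adGraph R f₂ f₃).Adj (Sum.inl a) (Sum.inl b) := by
  simp [adGraph]

@[simp]
lemma not_adGraph_adj_inr_inr (x y : R × R × R) :
    ¬ (adGraph R f₂ f₃).Adj (Sum.inr x) (Sum.inr y) := by
  simp [adGraph]

/-- The bipartition of `adGraph` into points and lines, as a two-colouring. -/
def adGraphColoring (R : Type*) [CommRing R] (f₂ f₃ : R × R → R) :
    (adGraph R f₂ f₃).Coloring Bool :=
  SimpleGraph.Coloring.mk Sum.isLeft (by rintro (a | a) (b | b) <;> simp)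

end adGraph

/-- A two-colourable graph without 4-cycles has girth at least six. -/
lemma SimpleGraph.six_le_egirth_of_coloring {V : Type*} {G : SimpleGraph V} (c : G.Coloring Bool)
    (h : ∀ a b p q, G.Adj a b → G.Adj b p → G.Adj p q → G.Adj q a → a = p ∨ b = q) :
    6 ≤ G.egirth := by
  rw [SimpleGraph.le_egirth]
  intro a w hw
  have heven : Even w.length := (c.even_length_iff_congr w).2 Iff.rfl
  have hthree := hw.three_le_length
  have hfour : w.length ≠ 4 := by
    intro hlen
    match w, hw, hlen with
    | .cons h₁ (.cons h₂ (.cons h₃ (.cons h₄ .nil))), hw, _ =>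
      have hnodup := hw.support_nodup
      simp only [SimpleGraph.Walk.support_cons, SimpleGraph.Walk.support_nil, List.tail_cons,
        List.nodup_cons, List.mem_cons, not_or] at hnodup
      rcases h _ _ _ _ h₁ h₂ h₃ h₄ with rfl | rfl <;> simp_all
  have hsix : 6 ≤ w.length := by
    obtain ⟨k, hk⟩ := heven
    omega
  exact_mod_cast hsix

/-- For odd exponents, the mixed second difference of `X ^ m * Y ^ n` vanishes only trivially. -/
lemma eq_or_eq_of_odd_pow_rectangle {m n : ℕ} (hm : Odd m) (hn : Odd n) {a b x y : ℝ}
    (h : a ^ m * x ^ n - b ^ m * x ^ n + b ^ m * y ^ n - a ^ m * y ^ n = 0) :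
    a = b ∨ x = y := by
  have hprod : (a ^ m - b ^ m) * (x ^ n - y ^ n) = 0 := by linear_combination h
  rcases mul_eq_zero.1 hprod with h | h
  · exact .inl (hm.strictMono_pow.injective (sub_eq_zero.1 h))
  · exact .inr (hn.strictMono_pow.injective (sub_eq_zero.1 h))

lemma monGraph_rectangle {s t u v : ℕ} (h : (Odd s ∧ Odd t) ∨ (Odd u ∧ Odd v))
    {a b x y : ℝ × ℝ × ℝ}
    (hax : (monGraph s t u v).Adj (Sum.inl a) (Sum.inr x))
    (hbx : (monGraph s t u v).Adj (Sum.inl b) (Sum.inr x))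
    (hby : (monGraph s t u v).Adj (Sum.inl b) (Sum.inr y))
    (hay : (monGraph s t u v).Adj (Sum.inl a) (Sum.inr y)) :
    a = b ∨ x = y := by
  obtain ⟨a₁, a₂, a₃⟩ := a
  obtain ⟨b₁, b₂, b₃⟩ := b
  obtain ⟨x₁, x₂, x₃⟩ := x
  obtain ⟨y₁, y₂, y₃⟩ := y
  simp only [monGraph, adGraph_adj_inl_inr] at hax hbx hby hay
  have hfirst : a₁ = b₁ ∨ x₁ = y₁ := by
    rcases h with ⟨hs, ht⟩ | ⟨hu, hv⟩
    · exact eq_or_eq_of_odd_pow_rectangle hs ht (by linarith)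
    · exact eq_or_eq_of_odd_pow_rectangle hu hv (by linarith)
  rcases hfirst with rfl | rfl
  · left
    simp only [Prod.mk.injEq, true_and]
    constructor <;> linarith
  · right
    simp only [Prod.mk.injEq, true_and]
    constructor <;> linarith

theorem girth_ge_six (s t u v : ℕ) (hs : 0 < s) (ht : 0 < t) (hu : 0 < u) (hv : 0 < v)
    (h : (Odd s ∧ Odd t) ∨ (Odd u ∧ Odd v)) :
    6 ≤ (monGraph s t u v).egirth := by
  refine SimpleGraph.six_le_egirth_of_coloring (adGraphColoring ℝ _ _) ?_
  rintro (a | a) (b | b) (p | p) (q | q) h₁ h₂ h₃ h₄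
  all_goals first
    | exact (not_adGraph_adj_inl_inl _ _ h₁).elim
    | exact (not_adGraph_adj_inr_inr _ _ h₁).elim
    | exact (not_adGraph_adj_inl_inl _ _ h₂).elim
    | exact (not_adGraph_adj_inr_inr _ _ h₂).elim
    | exact (not_adGraph_adj_inl_inl _ _ h₃).elim
    | exact (not_adGraph_adj_inr_inr _ _ h₃).elim
    | skip
  · simpa using monGraph_rectangle h h₁ h₂.symm h₃ h₄.symm
  · simpa [or_comm] using monGraph_rectangle h h₁.symm h₄ h₃.symm h₂
end

section
/- Let j, k, m be non-negative integers and n a positive integer with n ≤ k. Then the graph Γ_ℝ(X^{2j+1} Y^{2k+1}, X^{2m+1} Y^{2n}) has girth six. -/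
lemma monGraph_adj_inl_inr {s t u v : ℕ} {a x : ℝ × ℝ × ℝ} :
    (monGraph s t u v).Adj (Sum.inl a) (Sum.inr x) ↔
      a.2.1 + x.2.1 = a.1 ^ s * x.1 ^ t ∧ a.2.2 + x.2.2 = a.1 ^ u * x.1 ^ v := by
  obtain ⟨a₁, a₂, a₃⟩ := a
  obtain ⟨x₁, x₂, x₃⟩ := x
  simp [monGraph, adGraph]

lemma monGraph_not_adj_inl_inl {s t u v : ℕ} {a b : ℝ × ℝ × ℝ} :
    ¬ (monGraph s t u v).Adj (Sum.inl a) (Sum.inl b) := by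
  simp [monGraph, adGraph]

lemma monGraph_not_adj_inr_inr {s t u v : ℕ} {x y : ℝ × ℝ × ℝ} :
    ¬ (monGraph s t u v).Adj (Sum.inr x) (Sum.inr y) := by
  simp [monGraph, adGraph]

/-- The two-colouring of a monomial graph into points and lines. -/
noncomputable def monGraphColoring (s t u v : ℕ) : (monGraph s t u v).Coloring Bool :=
  SimpleGraph.Coloring.mk Sum.isLeft (by
    rintro (a | a) (b | b) h
    · exact absurd h monGraph_not_adj_inl_inl
    · simp
    · simp
    · exact absurd h monGraph_not_adj_inr_inr)

/-- When both exponents of the first monomial are odd, two points have at most one common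
neighbour. -/
lemma monGraph_eq_or_eq_of_common_neighbors {s t u v : ℕ} (hs : Odd s) (ht : Odd t)
    {a b x y : ℝ × ℝ × ℝ}
    (hax : (monGraph s t u v).Adj (Sum.inl a) (Sum.inr x))
    (hbx : (monGraph s t u v).Adj (Sum.inl b) (Sum.inr x))
    (hby : (monGraph s t u v).Adj (Sum.inl b) (Sum.inr y))
    (hay : (monGraph s t u v).Adj (Sum.inl a) (Sum.inr y)) : a = b ∨ x = y := by
  obtain ⟨a₁, a₂, a₃⟩ := a
  obtain ⟨b₁, b₂, b₃⟩ := b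
  obtain ⟨x₁, x₂, x₃⟩ := x
  obtain ⟨y₁, y₂, y₃⟩ := y
  rw [monGraph_adj_inl_inr] at hax hbx hby hay
  dsimp only at hax hbx hby hay
  have h : (a₁ ^ s - b₁ ^ s) * (x₁ ^ t - y₁ ^ t) = 0 := by
    linear_combination hbx.1 + hay.1 - hax.1 - hby.1
  rcases mul_eq_zero.1 h with h | h
  · left
    obtain rfl := hs.pow_inj.1 (sub_eq_zero.1 h)
    ext
    · rfl
    · dsimp only; linarith [hax.1, hbx.1]
    · dsimp only; linarith [hax.2, hbx.2]
  · right
    obtain rfl := ht.pow_inj.1 (sub_eq_zero.1 h)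
    ext
    · rfl
    · dsimp only; linarith [hax.1, hay.1]
    · dsimp only; linarith [hax.2, hay.2]

lemma monGraph_eq_or_eq_of_closed_four {s t u v : ℕ} (hs : Odd s) (ht : Odd t)
    {p q r w : (ℝ × ℝ × ℝ) ⊕ (ℝ × ℝ × ℝ)} (hpq : (monGraph s t u v).Adj p q)
    (hqr : (monGraph s t u v).Adj q r) (hrw : (monGraph s t u v).Adj r w)
    (hwp : (monGraph s t u v).Adj w p) : p = r ∨ q = w := by
  rcases p with p | p <;> rcases q with q | q <;> rcases r with r | r <;> rcases w with w | w <;>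
    first
    | exact absurd hpq monGraph_not_adj_inl_inl
    | exact absurd hpq monGraph_not_adj_inr_inr
    | exact absurd hqr monGraph_not_adj_inl_inl
    | exact absurd hqr monGraph_not_adj_inr_inr
    | exact absurd hrw monGraph_not_adj_inl_inl
    | exact absurd hrw monGraph_not_adj_inr_inr
    | simpa using monGraph_eq_or_eq_of_common_neighbors hs ht hpq hqr.symm hrw hwp.symm
    | simpa [or_comm] using
        monGraph_eq_or_eq_of_common_neighbors hs ht hpq.symm hwp hrw.symm hqr

lemma monGraph_six_le_egirth {s t : ℕ} (hs : Odd s) (ht : Odd t) (u v : ℕ) :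
    6 ≤ (monGraph s t u v).egirth := by
  rw [SimpleGraph.le_egirth]
  intro a w hw
  have h3 := hw.three_le_length
  have heven : Even w.length :=
    ((monGraphColoring s t u v).even_length_iff_congr w).2 Iff.rfl
  have h4 : w.length ≠ 4 := by
    intro h4
    have hadj (i : ℕ) (hi : i < 4) := w.adj_getVert_succ (i := i) (by lia)
    have hlast := hadj 3 (by lia)
    have hend : w.getVert 4 = w.getVert 0 := by
      rw [← h4, w.getVert_length, w.getVert_zero]
    simp only [Nat.reduceAdd, hend] at hlast
    rcases monGraph_eq_or_eq_of_closed_four hs ht (hadj 0 (by lia)) (hadj 1 (by lia))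
      (hadj 2 (by lia)) hlast with h | h
    · exact absurd (hw.getVert_injOn' (by simp) (by simp; lia) h) (by lia)
    · exact absurd (hw.getVert_injOn (by simp; lia) (by simp; lia) h) (by lia)
  have : 6 ≤ w.length := by
    obtain ⟨l, hl⟩ := heven
    lia
  exact_mod_cast this

/-- A six-cycle through the points with first coordinates `a, 1, 0` and the lines with first
coordinates `1, y, z`. -/
lemma monGraph_egirth_le_six {s t u v : ℕ} (hs : s ≠ 0) (hu : u ≠ 0) {a y z : ℝ}
    (ha0 : a ≠ 0) (ha1 : a ≠ 1) (hy1 : y ≠ 1) (hz1 : z ≠ 1) (hyz : y ≠ z)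
    (h₂ : a ^ s * (1 - z ^ t) = 1 - y ^ t) (h₃ : a ^ u * (1 - z ^ v) = 1 - y ^ v) :
    (monGraph s t u v).egirth ≤ 6 := by
  set G := monGraph s t u v with hG
  let P : ℝ × ℝ × ℝ := (a, 0, 0)
  let Q : ℝ × ℝ × ℝ := (1, 1 - a ^ s, 1 - a ^ u)
  let R : ℝ × ℝ × ℝ := (0, 1 - a ^ s - y ^ t, 1 - a ^ u - y ^ v)
  let X : ℝ × ℝ × ℝ := (1, a ^ s, a ^ u)
  let Y : ℝ × ℝ × ℝ := (y, a ^ s + y ^ t - 1, a ^ u + y ^ v - 1)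
  let Z : ℝ × ℝ × ℝ := (z, a ^ s + y ^ t - 1, a ^ u + y ^ v - 1)
  have hPX : G.Adj (Sum.inl P) (Sum.inr X) := by
    rw [hG, monGraph_adj_inl_inr]; simp [P, X]
  have hQX : G.Adj (Sum.inl Q) (Sum.inr X) := by
    rw [hG, monGraph_adj_inl_inr]; simp [Q, X]
  have hQY : G.Adj (Sum.inl Q) (Sum.inr Y) := by
    rw [hG, monGraph_adj_inl_inr]; simp only [Q, Y]; constructor <;> ring
  have hRY : G.Adj (Sum.inl R) (Sum.inr Y) := by
    rw [hG, monGraph_adj_inl_inr]; simp only [R, Y, zero_pow hs, zero_pow hu]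
    constructor <;> ring
  have hRZ : G.Adj (Sum.inl R) (Sum.inr Z) := by
    rw [hG, monGraph_adj_inl_inr]; simp only [R, Z, zero_pow hs, zero_pow hu]
    constructor <;> ring
  have hPZ : G.Adj (Sum.inl P) (Sum.inr Z) := by
    rw [hG, monGraph_adj_inl_inr]; simp only [P, Z]
    constructor <;> linarith
  have hPQ : P ≠ Q := fun h => ha1 (congrArg Prod.fst h)
  have hPR : P ≠ R := fun h => ha0 (congrArg Prod.fst h)
  have hQR : Q ≠ R := fun h => one_ne_zero (congrArg Prod.fst h)
  have hXY : X ≠ Y := fun h => hy1 (congrArg Prod.fst h).symm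
  have hXZ : X ≠ Z := fun h => hz1 (congrArg Prod.fst h).symm
  have hYZ : Y ≠ Z := fun h => hyz (congrArg Prod.fst h)
  let w : G.Walk (Sum.inl P) (Sum.inl P) :=
    .cons hPX (.cons hQX.symm (.cons hQY (.cons hRY.symm (.cons hRZ (.cons hPZ.symm .nil)))))
  have hw : w.IsCycle := by
    simp only [w, SimpleGraph.Walk.cons_isCycle_iff, SimpleGraph.Walk.cons_isPath_iff]
    simp [hPQ.symm, hPR.symm, hQR, hXY, hXZ, hYZ, hPQ, hPR]
  exact hw.egirth_le_length

lemma exists_pow_eq_of_odd {n : ℕ} (hn : Odd n) (r : ℝ) : ∃ a : ℝ, a ^ n = r := by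
  have hn0 : n ≠ 0 := hn.pos.ne'
  rcases le_total 0 r with hr | hr
  · exact ⟨_, Real.rpow_inv_natCast_pow hr hn0⟩
  · refine ⟨-((-r) ^ ((n : ℝ)⁻¹)), ?_⟩
    rw [hn.neg_pow, Real.rpow_inv_natCast_pow (by linarith) hn0, neg_neg]

/-- A continuous function that exceeds `c` at an interior point and is at most `c` at both ends
takes the value `c` twice. -/
lemma ContinuousOn.exists_eq_eq_of_le_of_lt {f : ℝ → ℝ} {a m b c : ℝ}
    (hf : ContinuousOn f (Set.Icc a b)) (ham : a ≤ m) (hmb : m ≤ b) (ha : f a ≤ c) (hb : f b ≤ c)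
    (hm : c < f m) :
    ∃ y z, y ∈ Set.Icc a b ∧ z ∈ Set.Icc a b ∧ y ≠ z ∧ f y = c ∧ f z = c := by
  obtain ⟨y, hy, hyc⟩ := intermediate_value_Icc ham
    (hf.mono (Set.Icc_subset_Icc_right hmb)) ⟨ha, hm.le⟩
  obtain ⟨z, hz, hzc⟩ := intermediate_value_Icc' hmb
    (hf.mono (Set.Icc_subset_Icc_left ham)) ⟨hb, hm.le⟩
  refine ⟨y, z, ⟨hy.1, hy.2.trans hmb⟩, ⟨ham.trans hz.1, hz.2⟩, ?_, hyc, hzc⟩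
  rintro rfl
  obtain rfl : y = m := le_antisymm hy.2 hz.1
  exact hm.ne' hyc

lemma exists_collision_of_lt {s t u v : ℕ} (ht : Odd t) (hv : Even v) (hv0 : v ≠ 0)
    (hus : u < s) :
    ∃ y z : ℝ, y ≠ z ∧ y ≠ 1 ∧ z ≠ 1 ∧
      (1 - y ^ v) ^ s * (1 - z ^ t) ^ u = (1 - z ^ v) ^ s * (1 - y ^ t) ^ u := by
  let S : ℕ → ℝ → ℝ := fun n x => ∑ i ∈ Finset.range n, x ^ i
  have hS (n : ℕ) (x : ℝ) : 1 - x ^ n = S n x * (1 - x) := (geom_sum_mul_neg x n).symm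
  have hSt (x : ℝ) : 0 < S t x := ht.geom_sum_pos
  let f : ℝ → ℝ := fun x => (1 - x ^ v) ^ (s - u) * S v x ^ u / S t x ^ u
  have hf : Continuous f := by
    have hSc (n : ℕ) : Continuous (S n) := by fun_prop
    exact (((by fun_prop : Continuous fun x : ℝ => (1 - x ^ v) ^ (s - u)).mul
      ((hSc v).pow u)).div ((hSc t).pow u) fun x => (pow_pos (hSt x) u).ne')
  have hsu : s - u ≠ 0 := by lia
  have hf1 : f 1 = 0 := by simp [f, hsu]
  have hf1' : f (-1) = 0 := by simp [f, hsu, hv.neg_one_pow]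
  have hf0 : f 0 = 1 := by
    have hS0 (n : ℕ) (hn : n ≠ 0) : S n 0 = 1 := by simpa [hn] using (hS n 0).symm
    simp [f, hS0 v hv0, hS0 t ht.pos.ne', hv0]
  have hmul (x : ℝ) : (1 - x ^ v) ^ s = f x * (1 - x ^ t) ^ u := by
    have : S t x ^ u ≠ 0 := (pow_pos (hSt x) u).ne'
    obtain ⟨d, rfl⟩ := Nat.exists_eq_add_of_lt hus
    have hd : u + d + 1 - u = d + 1 := by lia
    simp only [f, hd]
    rw [hS t x, mul_pow]
    field_simp
    rw [show u + d + 1 = (d + 1) + u by lia, pow_add, mul_assoc, ← mul_pow, ← hS v x]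
  obtain ⟨y, z, -, -, hyz, hy, hz⟩ := hf.continuousOn.exists_eq_eq_of_le_of_lt
    (a := -1) (m := 0) (b := 1) (c := 1 / 2) (by norm_num) (by norm_num)
    (by rw [hf1']; norm_num) (by rw [hf1]; norm_num) (by rw [hf0]; norm_num)
  refine ⟨y, z, hyz, ?_, ?_, ?_⟩
  · rintro rfl; rw [hf1] at hy; norm_num at hy
  · rintro rfl; rw [hf1] at hz; norm_num at hz
  · rw [hmul y, hmul z, hy, hz]; ring

lemma exists_collision_of_le {s t u v : ℕ} (hs : Odd s) (ht : Odd t) (hv : Even v) (hv0 : v ≠ 0)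
    (hvt : v < t) (hsu : s ≤ u) :
    ∃ y z : ℝ, y ≠ z ∧ y ≠ 1 ∧ z ≠ 1 ∧
      (1 - y ^ v) ^ s * (1 - z ^ t) ^ u = (1 - z ^ v) ^ s * (1 - y ^ t) ^ u := by
  let f : ℝ → ℝ := fun x => (x ^ v - 1) ^ s / (1 + x ^ t) ^ u
  have hpos {x : ℝ} (hx : 1 ≤ x) : 0 < (1 + x ^ t) ^ u := by positivity
  have hf1 : f 1 = 0 := by simp [f, hs.pos.ne']
  have hf2 : 0 < f 2 := div_pos
    (pow_pos (sub_pos.2 (one_lt_pow₀ (by norm_num) hv0)) s) (hpos (by norm_num))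
  have hfle {x : ℝ} (hx : 1 ≤ x) : f x ≤ x⁻¹ := by
    have hx0 : 0 < x := by linarith
    rw [div_le_iff₀ (hpos hx), inv_mul_eq_div, le_div_iff₀ hx0]
    have h1 : 0 ≤ x ^ v - 1 := sub_nonneg.2 (one_le_pow₀ hx)
    calc (x ^ v - 1) ^ s * x ≤ (x ^ v) ^ s * x := by gcongr; linarith
      _ = x ^ (v * s + 1) := by rw [← pow_mul, pow_succ]
      _ ≤ x ^ (t * u) := by
        refine pow_le_pow_right₀ hx ?_
        have := hs.pos
        nlinarith [Nat.mul_le_mul hvt hsu]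
      _ = (x ^ t) ^ u := pow_mul _ _ _
      _ ≤ (1 + x ^ t) ^ u := by gcongr; linarith
  let M : ℝ := max 2 (f 2 / 2)⁻¹
  have hfM : f M ≤ f 2 / 2 := by
    refine (hfle (one_le_two.trans (le_max_left _ _))).trans ?_
    exact inv_le_of_inv_le₀ (by linarith) (le_max_right _ _)
  have hf : ContinuousOn f (Set.Icc 1 M) := by
    refine ContinuousOn.div (by fun_prop) (by fun_prop) fun x hx => (hpos hx.1).ne'
  obtain ⟨y, z, hy1, hz1, hyz, hy, hz⟩ := hf.exists_eq_eq_of_le_of_lt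
    (m := 2) (c := f 2 / 2) (by norm_num) (le_max_left _ _) (by linarith) hfM (by linarith)
  have hmul {x : ℝ} (hx : 1 ≤ x) : (x ^ v - 1) ^ s = f x * (1 + x ^ t) ^ u :=
    (div_mul_cancel₀ _ (hpos hx).ne').symm
  have hneg {x : ℝ} (hx : 1 ≤ x) : (1 - (-x) ^ v) ^ s = - (f x * (1 - (-x) ^ t) ^ u) := by
    rw [hv.neg_pow, ht.neg_pow, sub_neg_eq_add, ← hmul hx, ← hs.neg_pow, neg_sub]
  refine ⟨-y, -z, fun h => hyz (neg_injective h), ?_, ?_, ?_⟩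
  · linarith [hy1.1]
  · linarith [hz1.1]
  · rw [hneg hy1.1, hneg hz1.1, hy, hz]; ring

lemma exists_collision {s t u v : ℕ} (hs : Odd s) (ht : Odd t) (hv : Even v) (hv0 : v ≠ 0)
    (hvt : v < t) :
    ∃ y z : ℝ, y ≠ z ∧ y ≠ 1 ∧ z ≠ 1 ∧
      (1 - y ^ v) ^ s * (1 - z ^ t) ^ u = (1 - z ^ v) ^ s * (1 - y ^ t) ^ u := by
  rcases lt_or_ge u s with h | h
  · exact exists_collision_of_lt ht hv hv0 h
  · exact exists_collision_of_le hs ht hv hv0 hvt h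

lemma exists_six_cycle_parameters {s t u v : ℕ} (hs : Odd s) (ht : Odd t) (hv : Even v)
    (hv0 : v ≠ 0) (hvt : v < t) :
    ∃ a y z : ℝ, a ≠ 0 ∧ a ≠ 1 ∧ y ≠ 1 ∧ z ≠ 1 ∧ y ≠ z ∧
      a ^ s * (1 - z ^ t) = 1 - y ^ t ∧ a ^ u * (1 - z ^ v) = 1 - y ^ v := by
  obtain ⟨y, z, hyz, hy1, hz1, h⟩ := exists_collision (u := u) hs ht hv hv0 hvt
  have hzt : 1 - z ^ t ≠ 0 := fun h0 =>
    hz1 (ht.pow_inj.1 (by rw [one_pow]; linarith))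
  obtain ⟨a, ha⟩ := exists_pow_eq_of_odd hs ((1 - y ^ t) / (1 - z ^ t))
  have ha' : a ^ s * (1 - z ^ t) = 1 - y ^ t := by rw [ha, div_mul_cancel₀ _ hzt]
  refine ⟨a, y, z, ?_, ?_, hy1, hz1, hyz, ha', ?_⟩
  · rintro rfl
    rw [zero_pow hs.pos.ne', zero_mul] at ha'
    exact hy1 (ht.pow_inj.1 (by rw [one_pow]; linarith))
  · rintro rfl
    rw [one_pow, one_mul] at ha'
    exact hyz (ht.pow_inj.1 (by linarith))
  · refine hs.pow_inj.1 (mul_right_cancel₀ (pow_ne_zero u hzt) ?_)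
    rw [h, ← ha', mul_pow, mul_pow]
    ring

theorem girth_six_of_n_le_k (j k m n : ℕ) (hn : 0 < n) (hnk : n ≤ k) :
    (monGraph (2 * j + 1) (2 * k + 1) (2 * m + 1) (2 * n)).egirth = 6 := by
  have hs : Odd (2 * j + 1) := ⟨j, rfl⟩
  have ht : Odd (2 * k + 1) := ⟨k, rfl⟩
  obtain ⟨a, y, z, ha0, ha1, hy1, hz1, hyz, h₂, h₃⟩ := exists_six_cycle_parameters
    (u := 2 * m + 1) hs ht (even_two_mul n) (by lia) (by lia)
  exact le_antisymm
    (monGraph_egirth_le_six (by lia) (by lia) ha0 ha1 hy1 hz1 hyz h₂ h₃)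
    (monGraph_six_le_egirth hs ht _ _)
end

section
/- Let k be a non-negative integer and n a positive integer with n > k. Then for all pairwise distinct real numbers x, y, z, one has (y^{2k+1} − x^{2k+1})(z^{2n} − x^{2n}) ≠ (z^{2k+1} − x^{2k+1})(y^{2n} − x^{2n}); equivalently, the 3×3 matrix with rows (1,1,1), (x^{2k+1}, y^{2k+1}, z^{2k+1}), (x^{2n}, y^{2n}, z^{2n}) has nonzero determinant. -/
theorem strictConvexOn_abs_rpow {p : ℝ} (hp : 1 < p) :
    StrictConvexOn ℝ Set.univ fun u : ℝ => |u| ^ p := by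
  refine ⟨convex_univ, fun u _ v _ huv a b ha hb hab => ?_⟩
  have hp0 : 0 < p := by linarith
  simp only [smul_eq_mul]
  have htri : |a * u + b * v| ≤ a * |u| + b * |v| := by
    simpa only [abs_mul, abs_of_pos ha, abs_of_pos hb] using abs_add_le (a * u) (b * v)
  by_cases h : |u| = |v|
  · have hv : u = -v := (abs_eq_abs.mp h).resolve_left huv
    have hv0 : 0 < |v| := abs_pos.mpr fun h0 => huv (by simp [hv, h0])
    have hlt : |a * u + b * v| < |v| := by
      have : a * u + b * v = (b - a) * v := by rw [hv]; ring
      rw [this, abs_mul]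
      exact mul_lt_of_lt_one_left hv0 (abs_lt.mpr ⟨by linarith, by linarith⟩)
    calc |a * u + b * v| ^ p < |v| ^ p := Real.rpow_lt_rpow (abs_nonneg _) hlt hp0
      _ = a * |u| ^ p + b * |v| ^ p := by rw [h, ← add_mul, hab, one_mul]
  · calc |a * u + b * v| ^ p ≤ (a * |u| + b * |v|) ^ p :=
          Real.rpow_le_rpow (abs_nonneg _) htri hp0.le
      _ < a * |u| ^ p + b * |v| ^ p :=
          (strictConvexOn_rpow hp).2 (abs_nonneg u) (abs_nonneg v) h ha hb hab

theorem StrictConvexOn.mul_sub_ne_mul_sub {s : Set ℝ} {f : ℝ → ℝ} (hf : StrictConvexOn ℝ s f)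
    {u v w : ℝ} (hu : u ∈ s) (hv : v ∈ s) (hw : w ∈ s)
    (huv : u ≠ v) (huw : u ≠ w) (hvw : v ≠ w) :
    (v - u) * (f w - f u) ≠ (w - u) * (f v - f u) := by
  have hne : (f v - f u) / (v - u) ≠ (f w - f u) / (w - u) := by
    rcases hvw.lt_or_gt with h | h
    · exact (hf.secant_strict_mono hu hv hw huv.symm huw.symm h).ne
    · exact (hf.secant_strict_mono hu hw hv huw.symm huv.symm h).ne'
  intro h
  apply hne
  rw [div_eq_div_iff (sub_ne_zero.mpr huv.symm) (sub_ne_zero.mpr huw.symm)]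
  linarith

theorem det_ne_zero (k n : ℕ) (hn : 0 < n) (hkn : k < n) (x y z : ℝ)
    (hxy : x ≠ y) (hxz : x ≠ z) (hyz : y ≠ z) :
    (y ^ (2 * k + 1) - x ^ (2 * k + 1)) * (z ^ (2 * n) - x ^ (2 * n)) ≠
      (z ^ (2 * k + 1) - x ^ (2 * k + 1)) * (y ^ (2 * n) - x ^ (2 * n)) ∧
    Matrix.det !![1, 1, 1;
                  x ^ (2 * k + 1), y ^ (2 * k + 1), z ^ (2 * k + 1);
                  x ^ (2 * n), y ^ (2 * n), z ^ (2 * n)] ≠ 0 := by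
  have hk : (0 : ℝ) < (2 * k + 1 : ℕ) := by positivity
  have hp : (1 : ℝ) < (2 * n : ℕ) / (2 * k + 1 : ℕ) := by
    rw [one_lt_div hk]
    exact_mod_cast (by omega : 2 * k + 1 < 2 * n)
  have hpow (t : ℝ) :
      |t ^ (2 * k + 1)| ^ (((2 * n : ℕ) : ℝ) / (2 * k + 1 : ℕ)) = t ^ (2 * n) := by
    rw [abs_pow, ← Real.rpow_natCast_mul (abs_nonneg t), mul_div_cancel₀ _ hk.ne',
      Real.rpow_natCast, (even_two_mul n).pow_abs]
  have hinj : Function.Injective fun t : ℝ => t ^ (2 * k + 1) :=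
    (odd_two_mul_add_one k).strictMono_pow.injective
  have key := (strictConvexOn_abs_rpow hp).mul_sub_ne_mul_sub (Set.mem_univ _) (Set.mem_univ _)
    (Set.mem_univ _) (hinj.ne hxy) (hinj.ne hxz) (hinj.ne hyz)
  simp only [hpow] at key
  refine ⟨key, fun h => key ?_⟩
  simp only [Matrix.det_fin_three, Matrix.of_apply, Matrix.cons_val] at h
  linear_combination h
end
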